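/- Let $d\ge 3$ and $p$ a symmetric nearest-neighbor kernel close to simple random walk. There exists $C=C(d,\eta)$ such that for $x,x'\in V_{\eta L}$ ($0<\eta<1$) and $z\in\partial V_L$: $|\pi^{(p)}_L(x,z)-\pi^{(p)}_L(x',z)| \le C\,|x-x'|\,L^{-d}$. -/

import Mathlib

open scoped Classical

noncomputable section

/-- The standard unit vector `e i` in `ℤ^d`. -/
def unitVec {d : ℕ} (i : Fin d) : Fin d → ℤ := fun j => if j = i then 1 else 0

/-- Euclidean norm of a lattice point. -/
def znorm {d : ℕ} (x : Fin d → ℤ) : ℝ := Real.sqrt (∑ i, ((x i : ℝ))^2)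

/-- One step of the symmetric nearest-neighbor walk with kernel `p`. -/
def stepOp {d : ℕ} (p : Fin d → ℝ) (f : (Fin d → ℤ) → ℝ) : (Fin d → ℤ) → ℝ :=
  fun x => ∑ i, p i * (f (x + unitVec i) + f (x - unitVec i))

/-- One step of the walk absorbed on the set `A`. -/
def stopOp {d : ℕ} (p : Fin d → ℝ) (A : Set (Fin d → ℤ)) (f : (Fin d → ℤ) → ℝ) :
    (Fin d → ℤ) → ℝ :=
  fun x => if x ∈ A then f x else stepOp p f x

/-- `exitProb p L x z`: probability that the `p`-walk started at `x` exits the ball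
`V_L = {y : |y| ≤ L}` precisely at `z`. -/
def exitProb {d : ℕ} (p : Fin d → ℝ) (L : ℝ) (x z : Fin d → ℤ) : ℝ :=
  ⨆ n : ℕ, (stopOp p {y | L < znorm y})^[n]
    (fun y => if L < znorm y ∧ y = z then (1:ℝ) else 0) x

/-- The outer boundary `∂V_L` of the discrete ball `V_L`. -/
def outerBoundary (d : ℕ) (L : ℝ) : Set (Fin d → ℤ) :=
  {z | L < znorm z ∧ ∃ i : Fin d, znorm (z - unitVec i) ≤ L ∨ znorm (z + unitVec i) ≤ L}


section aux

variable {d : ℕ}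

lemma znorm_eq_norm (x : Fin d → ℤ) :
    znorm x = ‖(WithLp.toLp 2 (fun i => (x i : ℝ)) : EuclideanSpace ℝ (Fin d))‖ := by
  rw [EuclideanSpace.norm_eq]
  simp [znorm]

lemma znorm_nonneg (x : Fin d → ℤ) : 0 ≤ znorm x := Real.sqrt_nonneg _

lemma znorm_sq (x : Fin d → ℤ) : znorm x ^ 2 = ∑ i, (x i : ℝ) ^ 2 :=
  Real.sq_sqrt (Finset.sum_nonneg fun _ _ => sq_nonneg _)

lemma znorm_add_le (x y : Fin d → ℤ) : znorm (x + y) ≤ znorm x + znorm y := by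
  simp only [znorm_eq_norm]
  refine le_trans (le_of_eq ?_) (norm_add_le _ _)
  congr 1
  ext i
  simp

lemma znorm_neg (x : Fin d → ℤ) : znorm (-x) = znorm x := by
  simp [znorm]

lemma znorm_sub_comm (x y : Fin d → ℤ) : znorm (x - y) = znorm (y - x) := by
  rw [← znorm_neg, neg_sub]

lemma znorm_zero : znorm (0 : Fin d → ℤ) = 0 := by
  simp [znorm]

lemma znorm_unitVec (i : Fin d) : znorm (unitVec i) = 1 := by
  simp [znorm, unitVec]

lemma abs_le_znorm (x : Fin d → ℤ) (i : Fin d) : |(x i : ℝ)| ≤ znorm x := by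
  apply Real.abs_le_sqrt
  exact Finset.single_le_sum (f := fun i => (x i : ℝ) ^ 2) (fun _ _ => sq_nonneg _)
    (Finset.mem_univ i)

lemma znorm_le_sum (x : Fin d → ℤ) : znorm x ≤ ∑ i, |(x i : ℝ)| := by
  apply Real.sqrt_le_iff.2
  refine ⟨Finset.sum_nonneg fun _ _ => abs_nonneg _, ?_⟩
  have := Finset.sum_sq_le_sq_sum_of_nonneg (s := Finset.univ) (f := fun i => |(x i : ℝ)|)
    (fun _ _ => abs_nonneg _)
  simpa using this

lemma znorm_mono (x y : Fin d → ℤ) (h : ∀ i, |x i| ≤ |y i|) : znorm x ≤ znorm y := by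
  apply Real.sqrt_le_sqrt
  apply Finset.sum_le_sum
  intro i _
  apply sq_le_sq.2
  exact_mod_cast h i

lemma sum_le_znorm (x : Fin d → ℤ) : ∑ i, |(x i : ℝ)| ≤ d * znorm x := by
  calc ∑ i, |(x i : ℝ)| ≤ ∑ _i : Fin d, znorm x := Finset.sum_le_sum fun i _ => abs_le_znorm x i
    _ = d * znorm x := by simp

lemma ball_finite (r : ℝ) : {y : Fin d → ℤ | znorm y ≤ r}.Finite := by
  apply (Set.finite_Icc (fun _ : Fin d => -⌈r⌉) (fun _ => ⌈r⌉)).subset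
  intro y hy
  have : ∀ i, |y i| ≤ ⌈r⌉ := by
    intro i
    have h1 := abs_le_znorm y i
    have h2 := Int.le_ceil r
    have : ((|y i| : ℤ) : ℝ) ≤ (⌈r⌉ : ℝ) := by
      push_cast
      exact h1.trans (le_trans hy h2)
    exact_mod_cast this
  exact ⟨fun i => (abs_le.1 (this i)).1, fun i => (abs_le.1 (this i)).2⟩

/-! Step operator -/

lemma stepOp_mono {p : Fin d → ℝ} (hp : ∀ i, 0 ≤ p i) {f g : (Fin d → ℤ) → ℝ} (x : Fin d → ℤ)
    (h : ∀ i, f (x + unitVec i) ≤ g (x + unitVec i) ∧ f (x - unitVec i) ≤ g (x - unitVec i)) :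
    stepOp p f x ≤ stepOp p g x := by
  apply Finset.sum_le_sum
  intro i _
  exact mul_le_mul_of_nonneg_left (add_le_add (h i).1 (h i).2) (hp i)

lemma stepOp_const {p : Fin d → ℝ} (hs : ∑ i, 2 * p i = 1) (c : ℝ) (x : Fin d → ℤ) :
    stepOp p (fun _ => c) x = c := by
  have : stepOp p (fun _ => c) x = (∑ i, 2 * p i) * c := by
    rw [Finset.sum_mul]
    apply Finset.sum_congr rfl
    intro i _
    ring
  rw [this, hs, one_mul]

lemma stepOp_sub (p : Fin d → ℝ) (f g : (Fin d → ℤ) → ℝ) (x : Fin d → ℤ) :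
    stepOp p (fun y => f y - g y) x = stepOp p f x - stepOp p g x := by
  simp only [stepOp]
  rw [← Finset.sum_sub_distrib]
  apply Finset.sum_congr rfl
  intro i _
  ring

lemma stepOp_add (p : Fin d → ℝ) (f g : (Fin d → ℤ) → ℝ) (x : Fin d → ℤ) :
    stepOp p (fun y => f y + g y) x = stepOp p f x + stepOp p g x := by
  simp only [stepOp]
  rw [← Finset.sum_add_distrib]
  apply Finset.sum_congr rfl
  intro i _
  ring

lemma stepOp_smul (p : Fin d → ℝ) (f : (Fin d → ℤ) → ℝ) (c : ℝ) (x : Fin d → ℤ) :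
    stepOp p (fun y => c * f y) x = c * stepOp p f x := by
  simp only [stepOp]
  rw [Finset.mul_sum]
  apply Finset.sum_congr rfl
  intro i _
  ring

lemma stepOp_coord {p : Fin d → ℝ} (hs : ∑ i, 2 * p i = 1) (i : Fin d) (x : Fin d → ℤ) :
    stepOp p (fun y => (y i : ℝ)) x = x i := by
  have : stepOp p (fun y => (y i : ℝ)) x = (∑ i, 2 * p i) * x i := by
    rw [Finset.sum_mul]
    apply Finset.sum_congr rfl
    intro j _
    simp only [Pi.add_apply, Pi.sub_apply]
    push_cast
    ring
  rw [this, hs, one_mul]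

lemma stepOp_coord_sq {p : Fin d → ℝ} (hs : ∑ i, 2 * p i = 1) (i : Fin d) (x : Fin d → ℤ) :
    stepOp p (fun y => (y i : ℝ) ^ 2) x = (x i : ℝ) ^ 2 + 2 * p i := by
  have : stepOp p (fun y => (y i : ℝ) ^ 2) x
      = (∑ j, 2 * p j) * (x i : ℝ) ^ 2 + ∑ j, if i = j then 2 * p j else 0 := by
    rw [Finset.sum_mul, ← Finset.sum_add_distrib]
    apply Finset.sum_congr rfl
    intro j _
    simp only [Pi.add_apply, Pi.sub_apply, unitVec]
    split_ifs <;> push_cast <;> ring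
  rw [this, hs, one_mul]
  simp

lemma stepOp_sq {p : Fin d → ℝ} (hs : ∑ i, 2 * p i = 1) (x : Fin d → ℤ) :
    stepOp p (fun y => znorm y ^ 2) x = znorm x ^ 2 + 1 := by
  have : stepOp p (fun y => znorm y ^ 2) x = ∑ i, stepOp p (fun y => (y i : ℝ) ^ 2) x := by
    simp only [stepOp, znorm_sq]
    rw [Finset.sum_comm]
    apply Finset.sum_congr rfl
    intro i _
    rw [← Finset.mul_sum, Finset.sum_add_distrib]
  rw [this]
  simp only [stepOp_coord_sq hs]
  rw [Finset.sum_add_distrib, hs, znorm_sq]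

/-! Properties of the exit probability -/

lemma stop_iter_mono {p : Fin d → ℝ} (hp : ∀ i, 0 ≤ p i) (A : Set (Fin d → ℤ))
    {f g : (Fin d → ℤ) → ℝ} (h : f ≤ g) : stopOp p A f ≤ stopOp p A g := by
  intro x
  unfold stopOp
  split_ifs
  · exact h x
  · exact stepOp_mono hp x fun i => ⟨h _, h _⟩

lemma exit_props {p : Fin d → ℝ} (hp : ∀ i, 0 ≤ p i) (hs : ∑ i, 2 * p i = 1) (L : ℝ)
    (z : Fin d → ℤ) :
    (∀ y, 0 ≤ exitProb p L y z) ∧ (∀ y, exitProb p L y z ≤ 1) ∧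
    (∀ y, L < znorm y → y ≠ z → exitProb p L y z = 0) ∧
    (∀ y, znorm y ≤ L → stepOp p (fun y => exitProb p L y z) y = exitProb p L y z) := by
  set A : Set (Fin d → ℤ) := {y | L < znorm y} with hA
  set f0 : (Fin d → ℤ) → ℝ := fun y => if L < znorm y ∧ y = z then (1:ℝ) else 0 with hf0
  set F : ℕ → (Fin d → ℤ) → ℝ := fun n => (stopOp p A)^[n] f0 with hF
  have hFs : ∀ n, F (n+1) = stopOp p A (F n) := fun n => Function.iterate_succ_apply' _ _ _
  have h0 : ∀ y, 0 ≤ f0 y := by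
    intro y; simp only [hf0]; split_ifs <;> norm_num
  have h1 : ∀ y, f0 y ≤ 1 := by
    intro y; simp only [hf0]; split_ifs <;> norm_num
  have hstep0 : f0 ≤ stopOp p A f0 := by
    intro y
    unfold stopOp
    split_ifs with h
    · exact le_rfl
    · have : f0 y = 0 := by
        simp only [hf0]; rw [if_neg]; rintro ⟨h', _⟩; exact h h'
      rw [this, ← stepOp_const hs 0 y]
      exact stepOp_mono hp y fun i => ⟨h0 _, h0 _⟩
  have hmono : Monotone F := by
    apply monotone_nat_of_le_succ
    intro n
    induction n with
    | zero => rw [hFs]; exact hstep0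
    | succ n ih =>
      rw [hFs (n+1)]
      conv_lhs => rw [hFs n]
      exact stop_iter_mono hp A ih
  have hle : ∀ n y, F n y ≤ 1 := by
    intro n
    induction n with
    | zero => exact h1
    | succ n ih =>
      intro y
      rw [hFs]
      unfold stopOp
      split_ifs
      · exact ih y
      · rw [← stepOp_const hs 1 y]
        exact stepOp_mono hp y fun i => ⟨ih _, ih _⟩
  have hge : ∀ n y, 0 ≤ F n y := fun n y => (h0 y).trans (hmono (Nat.zero_le n) y)
  have hu : ∀ y, exitProb p L y z = ⨆ n, F n y := fun y => rfl
  have hbdd : ∀ y, BddAbove (Set.range fun n => F n y) :=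
    fun y => ⟨1, by rintro _ ⟨n, rfl⟩; exact hle n y⟩
  have hlim : ∀ y, Filter.Tendsto (fun n => F n y) Filter.atTop (nhds (exitProb p L y z)) := by
    intro y
    exact tendsto_atTop_ciSup (fun a b h => hmono h y) (hbdd y)
  refine ⟨fun y => ge_of_tendsto' (hlim y) fun n => hge n y,
    fun y => le_of_tendsto' (hlim y) fun n => hle n y, ?_, ?_⟩
  · intro y hy hyz
    have : ∀ n, F n y = 0 := by
      intro n
      induction n with
      | zero => simp [hF, hf0, hyz]
      | succ n ih =>
        rw [hFs]
        unfold stopOp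
        rw [if_pos (by exact hy)]
        exact ih
    have h2 := hlim y
    simp only [this] at h2
    exact tendsto_nhds_unique h2 tendsto_const_nhds
  · intro y hy
    have h3 : Filter.Tendsto (fun n => F (n+1) y) Filter.atTop (nhds (exitProb p L y z)) :=
      (Filter.tendsto_add_atTop_iff_nat 1).2 (hlim y)
    have h4 : ∀ n, F (n+1) y = stepOp p (F n) y := by
      intro n
      rw [hFs]
      unfold stopOp
      rw [if_neg]
      simp only [hA, Set.mem_ofPred_eq, not_lt]
      exact hy
    simp only [h4] at h3
    have h5 : Filter.Tendsto (fun n => stepOp p (F n) y) Filter.atTop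
        (nhds (stepOp p (fun y => exitProb p L y z) y)) := by
      unfold stepOp
      apply tendsto_finsetSum
      intro i _
      exact ((hlim _).add (hlim _)).const_mul _
    exact tendsto_nhds_unique h5 h3

/-! Path lemma -/

lemma path_bound (f : (Fin d → ℤ) → ℝ) (x : Fin d → ℤ) (G : ℝ) :
    ∀ (n : ℕ) (x' : Fin d → ℤ), ∑ j, (x' j - x j).natAbs = n →
    (∀ y : Fin d → ℤ, (∀ j, |y j - x j| ≤ |x' j - x j|) → ∀ i,
      |f (y + unitVec i) - f y| ≤ G) → |f x' - f x| ≤ G * n := by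
  intro n
  induction n with
  | zero =>
    intro x' h _
    have : x' = x := by
      ext j
      have := (Finset.sum_eq_zero_iff.1 h) j (Finset.mem_univ j)
      omega
    simp [this]
  | succ n ih =>
    intro x' h hG
    obtain ⟨j, hj⟩ : ∃ j, x' j ≠ x j := by
      by_contra hc
      push Not at hc
      simp [hc] at h
    -- generic step
    have key : ∀ x'' : Fin d → ℤ, (∀ k, k ≠ j → x'' k = x' k) →
        (x'' j - x j).natAbs + 1 = (x' j - x j).natAbs → |f x' - f x''| ≤ G →
        |f x' - f x| ≤ G * ((n + 1 : ℕ) : ℝ) := by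
      intro x'' h1 h2 h3
      have hsum : ∑ k, (x'' k - x k).natAbs = n := by
        rw [← Finset.add_sum_erase _ _ (Finset.mem_univ j)] at h ⊢
        have : ∑ k ∈ Finset.univ.erase j, (x'' k - x k).natAbs
            = ∑ k ∈ Finset.univ.erase j, (x' k - x k).natAbs := by
          apply Finset.sum_congr rfl
          intro k hk
          rw [h1 k (Finset.ne_of_mem_erase hk)]
        rw [this]
        omega
      have hle : ∀ k, |x'' k - x k| ≤ |x' k - x k| := by
        intro k
        by_cases hk : k = j
        · subst hk; rw [Int.abs_eq_natAbs, Int.abs_eq_natAbs]; omega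
        · rw [h1 k hk]
      have := ih x'' hsum (fun y hy i => hG y (fun k => (hy k).trans (hle k)) i)
      have h4 := abs_sub_le (f x') (f x'') (f x)
      push_cast
      linarith
    rcases lt_or_gt_of_ne hj with hlt | hgt
    · apply key (x' + unitVec j)
      · intro k hk; simp [unitVec, hk]
      · simp [unitVec]; omega
      · rw [abs_sub_comm]
        exact hG x' (fun _ => le_rfl) j
    · apply key (x' - unitVec j)
      · intro k hk; simp [unitVec, hk]
      · simp [unitVec]; omega
      · have := hG (x' - unitVec j) (by
          intro k
          by_cases hk : k = j
          · subst hk; simp only [Pi.sub_apply, unitVec, if_true]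
            rw [Int.abs_eq_natAbs, Int.abs_eq_natAbs]; omega
          · simp [unitVec, hk]) j
        simpa using this

lemma path_bound' (f : (Fin d → ℤ) → ℝ) (x x' : Fin d → ℤ) (G : ℝ)
    (hG : ∀ y : Fin d → ℤ, (∀ j, |y j - x j| ≤ |x' j - x j|) → ∀ i,
      |f (y + unitVec i) - f y| ≤ G) :
    |f x' - f x| ≤ G * ∑ j, |((x' j - x j : ℤ) : ℝ)| := by
  have := path_bound f x G _ x' rfl hG
  convert this using 2
  push_cast
  apply Finset.sum_congr rfl
  intro j _
  rw [Nat.cast_natAbs]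
  push_cast
  rfl

/-! Gradient estimate by reflection -/

def refl0 (i : Fin d) (y : Fin d → ℤ) : Fin d → ℤ := fun j => if j = i then 1 - y i else y j

lemma stepOp_refl (p : Fin d → ℝ) (u : (Fin d → ℤ) → ℝ) (i : Fin d) (y : Fin d → ℤ) :
    stepOp p (fun k => u (refl0 i k)) y = stepOp p u (refl0 i y) := by
  unfold stepOp
  apply Finset.sum_congr rfl
  intro j _
  by_cases hj : j = i
  · subst hj
    have h1 : refl0 j (y + unitVec j) = refl0 j y - unitVec j := by
      ext k
      by_cases hk : k = j
      · subst hk; simp [refl0, unitVec]; try ring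
      · simp [refl0, unitVec, hk]
    have h2 : refl0 j (y - unitVec j) = refl0 j y + unitVec j := by
      ext k
      by_cases hk : k = j
      · subst hk; simp [refl0, unitVec]; try ring
      · simp [refl0, unitVec, hk]
    simp only [h1, h2]; ring
  · have h1 : refl0 i (y + unitVec j) = refl0 i y + unitVec j := by
      ext k
      by_cases hk : k = i
      · subst hk; simp [refl0, unitVec, Ne.symm hj]
      · simp [refl0, unitVec, hk]
    have h2 : refl0 i (y - unitVec j) = refl0 i y - unitVec j := by
      ext k
      by_cases hk : k = i
      · subst hk; simp [refl0, unitVec, Ne.symm hj]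
      · simp [refl0, unitVec, hk]
    simp only [h1, h2]

lemma grad_aux {p : Fin d → ℝ} (hp : ∀ i, 0 ≤ p i) (hs : ∑ i, 2 * p i = 1)
    (hd : 0 < d) (hlow : ∀ i, 1 / (4 * (d:ℝ)) ≤ p i)
    (u : (Fin d → ℤ) → ℝ) (r M : ℝ) (hr : 2 ≤ r) (hM : 0 < M)
    (hu : ∀ y, znorm y ≤ r → stepOp p u y = u y)
    (hb : ∀ y, znorm y ≤ r → |u y| ≤ M) (i : Fin d) :
    u (unitVec i) - u 0 ≤ 8 * (1 + 4 * d) * M / r := by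
  have hdR : (0:ℝ) < d := by exact_mod_cast hd
  set a : ℝ := 4 * d with ha
  set v : (Fin d → ℤ) → ℝ := fun k => u k - u (refl0 i k) with hv
  set ψ : (Fin d → ℤ) → ℝ := fun k =>
    znorm k ^ 2 + (-a * (k i : ℝ)^2 + a * (r + 1) * (k i : ℝ)) with hψ
  have hψstep : ∀ k, stepOp p ψ k ≤ ψ k - 1 := by
    intro k
    have h : stepOp p ψ k = ψ k + (1 - a * (2 * p i)) := by
      simp only [hψ]
      rw [stepOp_add p (fun k => znorm k ^ 2)
        (fun k => -a * (k i : ℝ)^2 + a * (r + 1) * (k i : ℝ)) k, stepOp_sq hs,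
        stepOp_add p (fun k => -a * (k i : ℝ)^2) (fun k => a * (r + 1) * (k i : ℝ)) k,
        stepOp_smul p (fun k => (k i : ℝ)^2), stepOp_smul p (fun k => (k i : ℝ)),
        stepOp_coord_sq hs, stepOp_coord hs]
      ring
    have h2 : 1 ≤ a * p i := by
      have := mul_le_mul_of_nonneg_left (hlow i) (show 0 ≤ a by positivity)
      rw [ha, mul_one_div_cancel (by positivity)] at this
      exact this
    rw [h]; linarith
  have hψge : ∀ k : Fin d → ℤ, 0 ≤ k i → (k i : ℝ) ≤ r + 1 → znorm k ^ 2 ≤ ψ k := by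
    intro k h1 h2
    have h1' : (0:ℝ) ≤ k i := by exact_mod_cast h1
    have : 0 ≤ a * ((k i : ℝ) * (r + 1 - k i)) :=
      mul_nonneg (by positivity) (mul_nonneg h1' (by linarith))
    simp only [hψ]; nlinarith
  set c : ℝ := 2 * M / (r - 1) ^ 2 with hc
  have hc0 : 0 < c := by
    have : 0 < r - 1 := by linarith
    positivity
  have hrefl : ∀ k : Fin d → ℤ, 1 ≤ k i → znorm k ≤ r → znorm (refl0 i k) ≤ r := by
    intro k h1 h2
    refine le_trans (znorm_mono _ _ ?_) h2
    intro j
    by_cases hj : j = i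
    · subst hj; simp only [refl0, if_true]; grind
    · simp [refl0, hj]
  have hci : ∀ k : Fin d → ℤ, znorm k ≤ r → (k i : ℝ) ≤ r :=
    fun k h => (le_abs_self _).trans ((abs_le_znorm k i).trans h)
  have hw : ∀ k : Fin d → ℤ, 1 ≤ k i → znorm k ≤ r → v k ≤ c * ψ k := by
    by_contra hcon
    push Not at hcon
    obtain ⟨k0, hk0, hk0r, hk0v⟩ := hcon
    have hfin : {k : Fin d → ℤ | 1 ≤ k i ∧ znorm k ≤ r}.Finite :=
      (ball_finite r).subset fun k hk => hk.2
    obtain ⟨k, ⟨hk1, hkr⟩, hkmax⟩ := hfin.exists_maximalFor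
      (fun k => v k - c * ψ k) _ ⟨k0, hk0, hk0r⟩
    have hmax : ∀ j : Fin d → ℤ, 1 ≤ j i → znorm j ≤ r → v j - c * ψ j ≤ v k - c * ψ k := by
      intro j h1 h2
      by_contra h
      push Not at h
      exact absurd (hkmax ⟨h1, h2⟩ h.le) (not_le.2 h)
    have hpos : 0 < v k - c * ψ k := by
      have := hmax k0 hk0 hk0r
      linarith
    have hψk : 0 ≤ ψ k :=
      (sq_nonneg _).trans (hψge k (by omega) (by linarith [hci k hkr]))
    have hkr1 : znorm k ≤ r - 1 := by
      by_contra h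
      push Not at h
      have h1 : (r - 1)^2 ≤ ψ k := by
        refine le_trans ?_ (hψge k (by omega) (by linarith [hci k hkr]))
        exact pow_le_pow_left₀ (by linarith) h.le 2
      have h2 : v k ≤ 2 * M := by
        have h3 := abs_le.1 (hb k hkr)
        have h4 := abs_le.1 (hb _ (hrefl k hk1 hkr))
        simp only [hv]; linarith [h3.2, h4.1]
      have h3 : 2 * M ≤ c * ψ k := by
        have : c * (r-1)^2 = 2 * M := by
          rw [hc]; exact div_mul_cancel₀ _ (pow_ne_zero 2 (by linarith))
        rw [← this]
        exact mul_le_mul_of_nonneg_left h1 hc0.le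
      linarith
    have hnb : ∀ j : Fin d → ℤ, 0 ≤ j i → znorm j ≤ r → (j i = 0 → j = k - unitVec i) →
        v j - c * ψ j ≤ v k - c * ψ k := by
      intro j h1 h2 h3
      rcases h1.lt_or_eq with h | h
      · exact hmax j (by omega) h2
      · have hj := h3 h.symm
        have hki : k i = 1 := by
          have := congrFun hj i
          simp [unitVec] at this
          omega
        have hvj : v j = - v k := by
          have e1 : refl0 i k = j := by
            rw [hj]; ext l
            by_cases hl : l = i
            · subst hl; simp [refl0, unitVec]; omega
            · simp [refl0, unitVec, hl]
          have e2 : refl0 i j = k := by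
            rw [hj]; ext l
            by_cases hl : l = i
            · subst hl; simp [refl0, unitVec]; omega
            · simp [refl0, unitVec, hl]
          simp only [hv, e1, e2]; ring
        have hψj : 0 ≤ ψ j :=
          (sq_nonneg _).trans (hψge j h1 (by linarith [hci j h2]))
        have := mul_nonneg hc0.le hψj
        have := mul_nonneg hc0.le hψk
        linarith
    have hle : stepOp p (fun j => v j - c * ψ j) k ≤ v k - c * ψ k := by
      rw [← stepOp_const hs (v k - c * ψ k) k]
      have hz : ∀ j : Fin d, znorm (k + unitVec j) ≤ r := fun j => by
        have := znorm_add_le k (unitVec j)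
        rw [znorm_unitVec] at this; linarith
      have hz' : ∀ j : Fin d, znorm (k - unitVec j) ≤ r := fun j => by
        have := znorm_add_le k (-unitVec j)
        rw [znorm_neg, znorm_unitVec, ← sub_eq_add_neg] at this; linarith
      apply stepOp_mono hp
      intro j
      refine ⟨hnb _ ?_ (hz j) ?_, hnb _ ?_ (hz' j) ?_⟩
      · simp only [Pi.add_apply, unitVec]; split_ifs <;> omega
      · intro h; exfalso; simp only [Pi.add_apply, unitVec] at h; split_ifs at h <;> omega
      · simp only [Pi.sub_apply, unitVec]; split_ifs <;> omega
      · intro h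
        by_cases hj : j = i
        · rw [hj]
        · exfalso; simp only [Pi.sub_apply, unitVec] at h
          rw [if_neg (Ne.symm hj)] at h; omega
    have hvk : stepOp p v k = v k := by
      simp only [hv]
      rw [stepOp_sub p u (fun k => u (refl0 i k)), stepOp_refl, hu k hkr,
        hu _ (hrefl k hk1 hkr)]
    rw [stepOp_sub p v (fun j => c * ψ j), stepOp_smul, hvk] at hle
    have := mul_le_mul_of_nonneg_left (hψstep k) hc0.le
    nlinarith
  have hfin := hw (unitVec i) (by simp [unitVec]) (by rw [znorm_unitVec]; linarith)
  have e0 : refl0 i (unitVec i) = 0 := by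
    ext l
    by_cases hl : l = i
    · subst hl; simp [refl0, unitVec]
    · simp [refl0, unitVec, hl]
  have e1 : ψ (unitVec i) = 1 + a * r := by
    simp only [hψ, znorm_unitVec]; simp [unitVec]; ring
  have e2 : v (unitVec i) = u (unitVec i) - u 0 := by simp only [hv, e0]
  rw [e1, e2] at hfin
  refine hfin.trans ?_
  rw [hc, div_mul_eq_mul_div, div_le_div_iff₀ (by nlinarith) (by linarith)]
  have ha0 : 0 < a := by positivity
  have q1 : r ^ 2 ≤ 4 * (r-1)^2 := by nlinarith
  have q2 : (1 + a * r) * r ≤ (1 + a) * r ^ 2 := by nlinarith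
  calc 2 * M * (1 + a * r) * r = 2 * M * ((1 + a * r) * r) := by ring
    _ ≤ 2 * M * ((1 + a) * (4 * (r-1)^2)) := by
      apply mul_le_mul_of_nonneg_left _ (by positivity)
      exact q2.trans (mul_le_mul_of_nonneg_left q1 (by positivity))
    _ = 8 * (1 + a) * M * (r - 1) ^ 2 := by ring

lemma grad {p : Fin d → ℝ} (hp : ∀ i, 0 ≤ p i) (hs : ∑ i, 2 * p i = 1)
    (hd : 0 < d) (hlow : ∀ i, 1 / (4 * (d:ℝ)) ≤ p i)
    (u : (Fin d → ℤ) → ℝ) (x : Fin d → ℤ) (r M : ℝ) (hr : 2 ≤ r) (hM : 0 < M)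
    (hu : ∀ y, znorm (y - x) ≤ r → stepOp p u y = u y)
    (hb : ∀ y, znorm (y - x) ≤ r → |u y| ≤ M) (i : Fin d) :
    |u (x + unitVec i) - u x| ≤ 8 * (1 + 4 * d) * M / r := by
  have hst : ∀ k, znorm k ≤ r → stepOp p (fun k => u (x + k)) k = u (x + k) := by
    intro k hk
    rw [← hu (x + k) (by simpa using hk)]
    simp only [stepOp, add_assoc, add_sub_assoc]
  have h1 := grad_aux hp hs hd hlow (fun k => u (x + k)) r M hr hM hst
    (fun k hk => hb (x + k) (by simpa using hk)) i
  have h2 := grad_aux hp hs hd hlow (fun k => (-1) * u (x + k)) r M hr hM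
    (fun k hk => by rw [stepOp_smul p (fun k => u (x + k)), hst k hk])
    (fun k hk => by simpa using hb (x + k) (by simpa using hk)) i
  simp only [add_zero] at h1 h2
  rw [abs_le]
  constructor <;> linarith

/-! Total mass bound -/

lemma stepOp_symm (p : Fin d → ℝ) (u w : (Fin d → ℤ) → ℝ) (hw : w.support.Finite) :
    Summable (fun y => u y * stepOp p w y) ∧
    ∑' y, u y * stepOp p w y = ∑' y, stepOp p u y * w y := by
  have hS : ∀ g : (Fin d → ℤ) → ℝ, Summable (fun y => g y * w y) := fun g =>
    summable_of_hasFiniteSupport (hw.subset fun y hy => right_ne_zero_of_mul hy)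
  have key : ∀ e : Fin d → ℤ, Summable (fun y => u y * w (y + e)) ∧
      ∑' y, u y * w (y + e) = ∑' y, u (y - e) * w y := by
    intro e
    have h := (Equiv.addRight e).tsum_eq (fun y => u (y - e) * w y)
    have h' := (Equiv.addRight e).summable_iff.2 (hS (fun y => u (y - e)))
    simp only [Equiv.coe_addRight, add_sub_cancel_right, Function.comp_def] at h h'
    exact ⟨h', h⟩
  have key2 : ∀ e : Fin d → ℤ, Summable (fun y => u y * w (y - e)) ∧
      ∑' y, u y * w (y - e) = ∑' y, u (y + e) * w y := by
    intro e
    have := key (-e)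
    simpa only [← sub_eq_add_neg, sub_neg_eq_add] using this
  have hterm : ∀ i : Fin d, Summable (fun y => p i * (u y * w (y + unitVec i)
      + u y * w (y - unitVec i))) := fun i =>
    (((key (unitVec i)).1).add (key2 (unitVec i)).1).mul_left _
  have e1 : (fun y => u y * stepOp p w y) = fun y => ∑ i, p i * (u y * w (y + unitVec i)
      + u y * w (y - unitVec i)) := by
    ext y
    simp only [stepOp, Finset.mul_sum]
    apply Finset.sum_congr rfl
    intro i _; ring
  have e2 : (fun y => stepOp p u y * w y) = fun y => ∑ i, p i * (u (y - unitVec i) * w y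
      + u (y + unitVec i) * w y) := by
    ext y
    simp only [stepOp, Finset.sum_mul]
    apply Finset.sum_congr rfl
    intro i _; ring
  rw [e1, e2]
  refine ⟨summable_sum fun i _ => hterm i, ?_⟩
  rw [Summable.tsum_finsetSum fun i _ => hterm i, Summable.tsum_finsetSum fun i _ =>
    ((hS (fun y => u (y - unitVec i))).add (hS (fun y => u (y + unitVec i)))).mul_left _]
  apply Finset.sum_congr rfl
  intro i _
  rw [tsum_mul_left, tsum_mul_left, Summable.tsum_add (key _).1 (key2 _).1,
    Summable.tsum_add (hS (fun y => u (y - unitVec i))) (hS (fun y => u (y + unitVec i))),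
    (key _).2, (key2 _).2]

lemma mass {p : Fin d → ℝ} (hp : ∀ i, 0 ≤ p i) (hs : ∑ i, 2 * p i = 1)
    (L : ℝ) (hL : 1 ≤ L) (z : Fin d → ℤ) (hz : L < znorm z)
    (u : (Fin d → ℤ) → ℝ) (h0 : ∀ y, 0 ≤ u y) (h1 : u z ≤ 1)
    (hout : ∀ y, L < znorm y → y ≠ z → u y = 0)
    (hu : ∀ y, znorm y ≤ L → stepOp p u y = u y)
    (B : Finset (Fin d → ℤ)) (hB : ∀ y ∈ B, znorm y ≤ L) :
    ∑ y ∈ B, u y ≤ 4 * L := by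
  set w : (Fin d → ℤ) → ℝ := fun y => if znorm y ≤ L then (L + 1)^2 - znorm y ^ 2 else 0 with hw
  have hwsupp : w.support.Finite := by
    apply (ball_finite L).subset
    intro y hy
    by_contra h
    exact hy (if_neg h)
  obtain ⟨hsum, hts⟩ := stepOp_symm p u w hwsupp
  have hsw : Summable (fun y => stepOp p u y * w y) :=
    summable_of_hasFiniteSupport (hwsupp.subset fun y hy => right_ne_zero_of_mul hy)
  have hzero : ∑' y, (stepOp p u y * w y - u y * stepOp p w y) = 0 := by
    rw [hsw.tsum_sub hsum, hts, sub_self]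
  -- pointwise lower bound
  have hin : ∀ y, znorm y ≤ L → u y ≤ stepOp p u y * w y - u y * stepOp p w y := by
    intro y hy
    have hq : stepOp p w y ≤ w y - 1 := by
      have e : stepOp p (fun y => (L+1)^2 - znorm y ^ 2) y = w y - 1 := by
        rw [stepOp_sub p (fun _ => (L+1)^2) (fun y => znorm y ^ 2), stepOp_const hs, stepOp_sq hs]
        simp only [hw, if_pos hy]; ring
      rw [← e]
      have hle : ∀ y', znorm y' ≤ L + 1 → w y' ≤ (L+1)^2 - znorm y' ^ 2 := by
        intro y' hy'
        simp only [hw]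
        split_ifs
        · exact le_rfl
        · have := pow_le_pow_left₀ (znorm_nonneg y') hy' 2
          linarith
      apply stepOp_mono hp
      intro i
      constructor
      · apply hle
        have := znorm_add_le y (unitVec i)
        rw [znorm_unitVec] at this; linarith
      · apply hle
        have := znorm_add_le y (-unitVec i)
        rw [znorm_neg, znorm_unitVec, ← sub_eq_add_neg] at this; linarith
    rw [hu y hy]
    nlinarith [h0 y]
  have hzb : stepOp p w z ≤ 4 * L := by
    rw [← stepOp_const hs (4 * L) z]
    have hle : ∀ y', znorm z ≤ znorm y' + 1 → w y' ≤ 4 * L := by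
      intro y' hy'
      simp only [hw]
      split_ifs
      · have : (L - 1)^2 ≤ znorm y' ^ 2 := pow_le_pow_left₀ (by linarith) (by linarith) 2
        nlinarith
      · linarith
    apply stepOp_mono hp
    intro i
    constructor
    · apply hle
      have := znorm_add_le (z + unitVec i) (-unitVec i)
      rw [znorm_neg, znorm_unitVec, add_neg_cancel_right] at this; exact this
    · apply hle
      have := znorm_add_le (z - unitVec i) (unitVec i)
      rw [znorm_unitVec, sub_add_cancel] at this; exact this
  have hzv : - (4 * L) ≤ stepOp p u z * w z - u z * stepOp p w z := by
    have : w z = 0 := if_neg (not_le.2 hz)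
    rw [this]
    nlinarith [h0 z, mul_le_mul_of_nonneg_left hzb (h0 z)]
  have hother : ∀ y, y ∉ insert z B → 0 ≤ stepOp p u y * w y - u y * stepOp p w y := by
    intro y hy
    by_cases h : znorm y ≤ L
    · exact (h0 y).trans (hin y h)
    · have e1 : w y = 0 := if_neg h
      have e2 : u y = 0 := hout y (not_le.1 h) (fun h => hy (by simp [h]))
      rw [e1, e2]; simp
  have hfin := (hsw.sub hsum).sum_le_tsum (insert z B) hother
  rw [hzero, Finset.sum_insert (fun h => absurd (hB z h) (not_le.2 hz))] at hfin
  have : ∑ y ∈ B, u y ≤ ∑ y ∈ B, (stepOp p u y * w y - u y * stepOp p w y) :=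
    Finset.sum_le_sum fun y hy => hin y (hB y hy)
  linarith

/-! Interior sup bound -/

lemma sup_bound {p : Fin d → ℝ} (hp : ∀ i, 0 ≤ p i) (hs : ∑ i, 2 * p i = 1)
    (hd : 0 < d) (hlow : ∀ i, 1 / (4 * (d:ℝ)) ≤ p i)
    (L : ℝ) (hL : 1 ≤ L) (u : (Fin d → ℤ) → ℝ) (h0 : ∀ y, 0 ≤ u y)
    (hu : ∀ y, znorm y ≤ L → stepOp p u y = u y)
    (hmass : ∀ B : Finset (Fin d → ℤ), (∀ y ∈ B, znorm y ≤ L) → ∑ y ∈ B, u y ≤ 4 * L)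
    (x : Fin d → ℤ) (hx : znorm x ≤ L) :
    (L - znorm x) ^ d * u x ≤ 8 * (8 * d * (8 * (1 + 4 * d)) * 2 ^ d) ^ d * L := by
  have hdR : (1:ℝ) ≤ d := by exact_mod_cast hd
  set Cg : ℝ := 8 * (1 + 4 * d) with hCg
  have hCg1 : 8 ≤ Cg := by rw [hCg]; linarith
  have h2d : (1:ℝ) ≤ 2 ^ d := one_le_pow₀ (by norm_num)
  set E : ℝ := 4 * d * Cg * 2 ^ d with hE
  have hdC : 8 ≤ d * Cg := by nlinarith
  have hdCE : 4 * (d * Cg) ≤ E := by rw [hE]; nlinarith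
  have hE0 : 0 < E := by linarith
  obtain ⟨y0, hy0, hy0max⟩ := (ball_finite (d := d) L).exists_maximalFor
    (fun y => (L - znorm y) ^ d * u y) _ ⟨x, hx⟩
  have hy0 : znorm y0 ≤ L := hy0
  have hmax : ∀ y, znorm y ≤ L → (L - znorm y) ^ d * u y ≤ (L - znorm y0) ^ d * u y0 := by
    intro y hy
    by_contra h
    push Not at h
    exact absurd (hy0max hy h.le) (not_le.2 h)
  refine (hmax x hx).trans ?_
  have hRHS : 0 ≤ 8 * (8 * d * Cg * 2 ^ d) ^ d * L := by positivity
  rcases (h0 y0).eq_or_lt with hU | hU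
  · rw [← hU]; simpa using hRHS
  rcases hy0.eq_or_lt with hLy | hLy
  · rw [hLy, sub_self, zero_pow hd.ne']; simpa using hRHS
  set U := u y0 with hUdef
  set ρ : ℝ := (L - znorm y0) / 2 with hρ
  have hρ0 : 0 < ρ := by rw [hρ]; linarith
  have hLρ : L - znorm y0 = 2 * ρ := by rw [hρ]; ring
  have hball : ∀ y, znorm (y - y0) ≤ ρ → znorm y ≤ L ∧ u y ≤ 2 ^ d * U := by
    intro y hy
    have h1 := znorm_add_le (y - y0) y0
    rw [sub_add_cancel] at h1
    have h2 : ρ ≤ L - znorm y := by linarith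
    have h3 : znorm y ≤ L := by linarith
    refine ⟨h3, ?_⟩
    have h4 := hmax y h3
    rw [hLρ, mul_pow] at h4
    have h5 : ρ ^ d * u y ≤ (L - znorm y) ^ d * u y :=
      mul_le_mul_of_nonneg_right (pow_le_pow_left₀ hρ0.le h2 d) (h0 y)
    have h6 : ρ ^ d * u y ≤ ρ ^ d * (2 ^ d * U) := by linarith
    exact le_of_mul_le_mul_left h6 (by positivity)
  set m : ℕ := ⌊ρ / E⌋₊ with hm
  have hmle : (m:ℝ) ≤ ρ / E := Nat.floor_le (by positivity)
  have hmE : (m:ℝ) * E ≤ ρ := (le_div_iff₀ hE0).1 hmle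
  have hmlt : ρ / E < m + 1 := Nat.lt_floor_add_one _
  have hm0 : (0:ℝ) ≤ m := Nat.cast_nonneg m
  set B : Finset (Fin d → ℤ) := Finset.Icc (fun j => y0 j - m) (fun j => y0 j + m) with hB
  have hBabs : ∀ y ∈ B, ∀ j, |y j - y0 j| ≤ m := by
    intro y hy j
    rw [hB, Finset.mem_Icc] at hy
    have h1 := hy.1 j
    have h2 := hy.2 j
    simp only at h1 h2
    rw [abs_le]; constructor <;> linarith
  have hsumle : ∀ y : Fin d → ℤ, (∀ j, |y j - y0 j| ≤ m) →
      ∑ j, |((y j - y0 j : ℤ) : ℝ)| ≤ d * m := by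
    intro y hy
    calc ∑ j, |((y j - y0 j : ℤ) : ℝ)| ≤ ∑ _j : Fin d, (m : ℝ) := by
          apply Finset.sum_le_sum
          intro j _
          exact_mod_cast hy j
      _ = d * m := by simp
  have hdm : d * (m:ℝ) ≤ ρ / 2 := by
    have : d * (m:ℝ) * 2 ≤ m * E := by
      have : 2 * (d:ℝ) ≤ E := by nlinarith
      nlinarith
    linarith
  have hBnorm : ∀ y : Fin d → ℤ, (∀ j, |y j - y0 j| ≤ m) → znorm (y - y0) ≤ ρ / 2 := by
    intro y hy
    exact (znorm_le_sum _).trans ((hsumle y hy).trans hdm)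
  have hhalf : ∀ y ∈ B, U / 2 ≤ u y := by
    intro y hy
    have hyj := hBabs y hy
    rcases Nat.eq_zero_or_pos m with hm00 | hmpos
    · have : y = y0 := by
        ext j
        have := hyj j
        rw [hm00] at this
        rw [Int.abs_eq_natAbs] at this
        omega
      rw [this]; linarith
    · have hm1 : (1:ℝ) ≤ m := by exact_mod_cast hmpos
      have hρE : E ≤ ρ := by nlinarith
      have hG : ∀ y' : Fin d → ℤ, (∀ j, |y' j - y0 j| ≤ |y j - y0 j|) → ∀ i,
          |u (y' + unitVec i) - u y'| ≤ Cg * (2 ^ d * U) / (ρ / 2) := by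
        intro y' hy' i
        have hn := hBnorm y' (fun j => (hy' j).trans (hyj j))
        have hin : ∀ k, znorm (k - y') ≤ ρ / 2 → znorm (k - y0) ≤ ρ := by
          intro k hk
          have := znorm_add_le (k - y') (y' - y0)
          rw [sub_add_sub_cancel] at this
          linarith
        refine grad hp hs hd hlow u y' (ρ / 2) (2 ^ d * U) (by linarith) (by positivity)
          (fun k hk => hu k (hball k (hin k hk)).1) (fun k hk => ?_) i
        rw [abs_of_nonneg (h0 k)]
        exact (hball k (hin k hk)).2
      have h1 := path_bound' u y0 y _ hG
      have h2 : Cg * (2 ^ d * U) / (ρ / 2) * ∑ j, |((y j - y0 j : ℤ) : ℝ)| ≤ U / 2 := by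
        calc _ ≤ Cg * (2 ^ d * U) / (ρ / 2) * (d * m) :=
              mul_le_mul_of_nonneg_left (hsumle y hyj) (by positivity)
          _ = (U / 2) * (m * E) / ρ := by rw [hE]; field_simp; ring
          _ ≤ (U / 2) * ρ / ρ := by gcongr
          _ = U / 2 := by field_simp
      have h3 := (abs_le.1 (h1.trans h2)).1
      linarith
  have hcard : (B.card : ℝ) = (2 * m + 1) ^ d := by
    rw [hB, Pi.card_Icc]
    simp only [Int.card_Icc]
    have : ∀ j, (y0 j + (m:ℤ) + 1 - (y0 j - m)).toNat = 2 * m + 1 := by intro j; omega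
    simp [this]
  have hsumB := hmass B (fun y hy => (hball y (by linarith [hBnorm y (hBabs y hy)])).1)
  have hsumB2 : (2 * (m:ℝ) + 1) ^ d * (U / 2) ≤ ∑ y ∈ B, u y := by
    rw [← hcard, ← nsmul_eq_mul]
    exact Finset.card_nsmul_le_sum _ _ _ hhalf
  have h7 : (ρ / E) ^ d ≤ (2 * (m:ℝ) + 1) ^ d :=
    pow_le_pow_left₀ (by positivity) (by linarith) d
  have h8 : (ρ / E) ^ d * (U / 2) ≤ 4 * L :=
    (mul_le_mul_of_nonneg_right h7 (by linarith)).trans (hsumB2.trans hsumB)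
  have h9 : 8 * d * Cg * 2 ^ d = 2 * E := by rw [hE]; ring
  rw [hLρ, h9]
  calc (2 * ρ) ^ d * U = (2 * E) ^ d * 2 * ((ρ / E) ^ d * (U / 2)) := by
        have e : (2 * ρ) ^ d = (2 * E) ^ d * (ρ / E) ^ d := by
          rw [← mul_pow]; congr 1; field_simp
        rw [e]; ring
    _ ≤ (2 * E) ^ d * 2 * (4 * L) := mul_le_mul_of_nonneg_left h8 (by positivity)
    _ = 8 * (2 * E) ^ d * L := by ring

end aux

/-- for `d ≥ 3`, `0 < η < 1` and symmetric nearest-neighbor kernels `p`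
close enough to simple random walk, there is `C = C(d,η)` such that for large `L`, all
`x, x' ∈ V_{ηL}` and `z ∈ ∂V_L`:
`|π_L^{(p)}(x,z) - π_L^{(p)}(x',z)| ≤ C |x-x'| L^{-d}`. -/
theorem stmt11 (d : ℕ) (hd : 3 ≤ d) :
    ∃ κ₀ > (0:ℝ), ∀ η : ℝ, 0 < η → η < 1 →
      ∃ C > (0:ℝ), ∃ L₀ : ℝ, 1 ≤ L₀ ∧ ∀ L : ℝ, L₀ ≤ L →
        ∀ p : Fin d → ℝ, (∀ i, 0 ≤ p i) → (∑ i, 2 * p i = 1) →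
          (∀ i, |p i - 1/(2*(d:ℝ))| ≤ κ₀) →
          ∀ x x' : Fin d → ℤ, znorm x ≤ η * L → znorm x' ≤ η * L →
            ∀ z ∈ outerBoundary d L,
              |exitProb p L x z - exitProb p L x' z| ≤
                C * znorm (x - x') * L ^ (-(d:ℝ)) := by

  have hd0 : 0 < d := by omega
  have hdR : (1:ℝ) ≤ d := by exact_mod_cast hd0
  refine ⟨1 / (4 * d), by positivity, ?_⟩
  intro η hη0 hη1
  have h1η : 0 < 1 - η := by linarith
  set K : ℝ := 8 * (8 * d * (8 * (1 + 4 * d)) * 2 ^ d) ^ d with hK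
  have hK0 : 0 < K := by positivity
  set Cg : ℝ := 8 * (1 + 4 * d) with hCg
  have hCg0 : 0 < Cg := by positivity
  set q : ℝ := (1 - η) / 4 with hq
  have hq0 : 0 < q := by rw [hq]; linarith
  have hq4 : q * 4 = 1 - η := by rw [hq]; ring
  refine ⟨(Cg * d + 1) * (K / ((2 * q) ^ d * q)), by positivity, 2 / q, ?_, ?_⟩
  · rw [le_div_iff₀ hq0]; linarith
  intro L hL p hp hs hclose x x' hx hx' z hz
  have hqL : 2 ≤ q * L := by
    rw [div_le_iff₀ hq0] at hL; linarith
  have hL1 : 1 ≤ L := by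
    refine le_trans ?_ hL
    rw [le_div_iff₀ hq0]; linarith
  have hL0 : 0 < L := by linarith
  have hlow : ∀ i, 1 / (4 * (d:ℝ)) ≤ p i := by
    intro i
    have h := (abs_le.1 (hclose i)).1
    have e : 1 / (2 * (d:ℝ)) = 2 * (1 / (4 * (d:ℝ))) := by field_simp; norm_num
    rw [e] at h
    linarith
  obtain ⟨h0, h1, hout, hu⟩ := exit_props hp hs L z
  set u : (Fin d → ℤ) → ℝ := fun y => exitProb p L y z with hudef
  have hsup := sup_bound hp hs hd0 hlow L hL1 u h0 hu
    (mass hp hs L hL1 z hz.1 u h0 (h1 z) hout hu)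
  set δ : ℝ := q * L with hδ
  have hδ0 : 0 < δ := by positivity
  have hδL : η * L + 4 * δ = L := by
    rw [hδ]; linear_combination L * hq4
  set M : ℝ := K * L / (2 * δ) ^ d with hM
  have hM0 : 0 < M := by positivity
  have hMb : ∀ y, znorm y ≤ η * L + 2 * δ → u y ≤ M := by
    intro y hy
    have h2 := hsup y (by linarith)
    rw [hM, le_div_iff₀ (by positivity), mul_comm]
    refine le_trans ?_ h2
    exact mul_le_mul_of_nonneg_right (pow_le_pow_left₀ (by linarith) (by linarith) d) (h0 y)
  have hmain : |u x - u x'| ≤ (Cg * d + 1) * (M / δ) * znorm (x - x') := by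
    have hMδ : 0 < M / δ := by positivity
    have hzn := znorm_nonneg (x - x')
    rcases le_or_gt δ (znorm (x - x')) with hfar | hnear
    · have hA : |u x - u x'| ≤ M := by
        have a1 := hMb x (by linarith)
        have a2 := hMb x' (by linarith)
        have a3 : 0 ≤ u x := h0 x
        have a4 : 0 ≤ u x' := h0 x'
        rw [abs_le]; constructor <;> linarith
      have hB : M ≤ (M / δ) * znorm (x - x') := by
        calc M = (M / δ) * δ := by field_simp
          _ ≤ _ := mul_le_mul_of_nonneg_left hfar hMδ.le
      have hC : 0 ≤ Cg * d * ((M / δ) * znorm (x - x')) := by positivity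
      linarith
    · have hG : ∀ y : Fin d → ℤ, (∀ j, |y j - x' j| ≤ |x j - x' j|) → ∀ i,
          |u (y + unitVec i) - u y| ≤ Cg * M / δ := by
        intro y hy i
        have hyn : znorm (y - x') ≤ znorm (x - x') := znorm_mono _ _ hy
        have hin : ∀ k, znorm (k - y) ≤ δ → znorm k ≤ η * L + 2 * δ := by
          intro k hk
          have b1 := znorm_add_le (k - y) y
          have b2 := znorm_add_le (y - x') x'
          rw [sub_add_cancel] at b1 b2
          linarith
        refine grad hp hs hd0 hlow u y δ M hqL hM0
          (fun k hk => hu k (by linarith [hin k hk])) (fun k hk => ?_) i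
        rw [abs_of_nonneg (h0 k)]
        exact hMb k (hin k hk)
      have c1 := path_bound' u x' x _ hG
      have c2 := sum_le_znorm (x - x')
      have c3 : ∑ j, |((x j - x' j : ℤ) : ℝ)| ≤ d * znorm (x - x') := c2
      have c4 : Cg * M / δ * ∑ j, |((x j - x' j : ℤ) : ℝ)| ≤ Cg * M / δ * (d * znorm (x - x')) :=
        mul_le_mul_of_nonneg_left c3 (by positivity)
      have c5 : Cg * M / δ * (d * znorm (x - x')) = Cg * d * ((M / δ) * znorm (x - x')) := by ring
      have c6 : 0 ≤ (M / δ) * znorm (x - x') := by positivity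
      linarith
  refine hmain.trans (le_of_eq ?_)
  rw [Real.rpow_neg hL0.le, Real.rpow_natCast, hM, hδ, show 2 * (q * L) = (2 * q) * L by ring,
    mul_pow (2 * q) L d]
  field_simp
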